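/- Let K : ℕ₀×ℕ₀ → [0,∞) be a symmetric kernel (K_{j,k} = K_{k,j}) satisfying K_{j,k} ≤ C_q (j^μ k^ν + j^ν k^μ) for all j,k ∈ ℕ₀, where μ, ν ∈ [0,2], μ + ν ≤ 3, and C_q > 0. Assume max{μ,ν} ≤ 1 and let f(0) = (f_j(0))_{j≥0} ∈ Y_1^+. Then the EDG system has a global mild solution f = (f_j)_{j≥0} on [0,∞) such that f(t) ∈ Y_1^+ for every t ∈ [0,∞). -/

import Mathlib

open MeasureTheory Filter

noncomputable section

/-- Membership in the positive cone `Y_r^+`: componentwise nonnegative sequences with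
`∑ j^r f_j < ∞`. -/
def MemYplus (r : ℝ) (g : ℕ → ℝ) : Prop :=
  (∀ j, 0 ≤ g j) ∧ Summable (fun j : ℕ => (j : ℝ) ^ r * g j)

/-- The `p`-th moment `M_p(g) = ∑_{j=0}^∞ j^p g_j`. -/
def mom (p : ℝ) (g : ℕ → ℝ) : ℝ := ∑' j : ℕ, (j : ℝ) ^ p * g j

/-- Right-hand side of the infinite EDG system. -/
def edgRHS (K : ℕ → ℕ → ℝ) (g : ℕ → ℝ) : ℕ → ℝ
  | 0 => g 1 * (∑' k : ℕ, K 1 k * g k) - g 0 * (∑' k : ℕ, K (k + 1) 0 * g (k + 1))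
  | m + 1 =>
      g (m + 2) * (∑' k : ℕ, K (m + 2) k * g k) - g (m + 1) * (∑' k : ℕ, K (m + 1) k * g k)
        - g (m + 1) * (∑' k : ℕ, K (k + 1) (m + 1) * g (k + 1))
        + g m * (∑' k : ℕ, K (k + 1) m * g (k + 1))

/-- Mild solution of the EDG system on a time set `S` (containing `0`), with values in
`Y_r^+`. -/
def IsMildSolutionOn (K : ℕ → ℕ → ℝ) (r : ℝ) (f : ℝ → ℕ → ℝ) (S : Set ℝ) : Prop :=
  (∀ t ∈ S, MemYplus r (f t)) ∧
  (∀ j : ℕ, ContinuousOn (fun t => f t j) S) ∧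
  (∃ B : ℝ, ∀ t ∈ S, (∑' j : ℕ, (j : ℝ) ^ r * f t j) ≤ B) ∧
  (∀ t ∈ S, ∀ j : ℕ, Summable (fun k : ℕ => K j k * f t k)) ∧
  (∀ t ∈ S, ∀ j : ℕ,
    MeasureTheory.IntegrableOn (fun s => ∑' k : ℕ, K j k * f s k) (Set.Icc 0 t)) ∧
  (∀ t ∈ S, f t 0 = f 0 0 + ∫ s in (0:ℝ)..t,
      (f s 1 * (∑' k : ℕ, K 1 k * f s k) - f s 0 * (∑' k : ℕ, K (k + 1) 0 * f s (k + 1)))) ∧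
  (∀ t ∈ S, ∀ m : ℕ, f t (m + 1) = f 0 (m + 1) + ∫ s in (0:ℝ)..t,
      (f s (m + 2) * (∑' k : ℕ, K (m + 2) k * f s k)
        - f s (m + 1) * (∑' k : ℕ, K (m + 1) k * f s k)
        - f s (m + 1) * (∑' k : ℕ, K (k + 1) (m + 1) * f s (k + 1))
        + f s m * (∑' k : ℕ, K (k + 1) m * f s (k + 1))))

/-- Classical (continuously differentiable) solution of the EDG system on a time set `S`. -/
def IsClassicalSolutionOn (K : ℕ → ℕ → ℝ) (f : ℝ → ℕ → ℝ) (S : Set ℝ) : Prop :=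
  (∀ t ∈ S, ∀ j : ℕ, Summable (fun k : ℕ => K j k * f t k) ∧
      Summable (fun k : ℕ => K (k + 1) j * f t (k + 1))) ∧
  (∀ t ∈ S, ∀ j : ℕ, HasDerivWithinAt (fun s => f s j) (edgRHS K (f t) j) S t) ∧
  (∀ j : ℕ, ContinuousOn (fun t => edgRHS K (f t) j) S)

/-- Right-hand side of the truncated EDG system with `N+1` equations. -/
def truncRHS (K : ℕ → ℕ → ℝ) (N : ℕ) (g : ℕ → ℝ) (j : ℕ) : ℝ :=
  if j = 0 then
    g 1 * (∑ k ∈ Finset.range N, K 1 k * g k) - g 0 * (∑ k ∈ Finset.Icc 1 N, K k 0 * g k)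
  else if j = N then
    - g N * (∑ k ∈ Finset.range N, K N k * g k)
      + g (N - 1) * (∑ k ∈ Finset.Icc 1 N, K k (N - 1) * g k)
  else
    g (j + 1) * (∑ k ∈ Finset.range N, K (j + 1) k * g k)
      - g j * (∑ k ∈ Finset.range N, K j k * g k)
      - g j * (∑ k ∈ Finset.Icc 1 N, K k j * g k)
      + g (j - 1) * (∑ k ∈ Finset.Icc 1 N, K k (j - 1) * g k)

/-- `fN` is a (global, `C¹`) solution of the truncated EDG system of size `N`. -/
def IsTruncSolution (K : ℕ → ℕ → ℝ) (N : ℕ) (fN : ℝ → ℕ → ℝ) : Prop :=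
  ∀ t : ℝ, ∀ j ≤ N, HasDerivAt (fun s => fN s j) (truncRHS K N (fN t) j) t

/-- The gelation time `T_gel = inf { t ≥ 0 : ∑ j f_j(t) < ∑ j f_j(0) }`. -/
def gelTime (f : ℝ → ℕ → ℝ) : ℝ :=
  sInf { t : ℝ | 0 ≤ t ∧ (∑' j : ℕ, (j : ℝ) * f t j) < ∑' j : ℕ, (j : ℝ) * f 0 j }

/-- The class `𝒢_{1,∞}`: a nonnegative convex `C²` function `G` on `[0,∞)` with derivative
`G'`, such that `G(0) = G'(0) = 0`, `G'` is concave and positive on `(0,∞)`, and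
`G'(x) → ∞`, `G(x)/x → ∞` as `x → ∞`. -/
structure G1Inf where
  G : ℝ → ℝ
  G' : ℝ → ℝ
  hasDeriv : ∀ x ∈ Set.Ici (0:ℝ), HasDerivWithinAt G (G' x) (Set.Ici 0) x
  contDiff : ContDiffOn ℝ 2 G (Set.Ici 0)
  nonneg : ∀ x ∈ Set.Ici (0:ℝ), 0 ≤ G x
  convex : ConvexOn ℝ (Set.Ici 0) G
  zero : G 0 = 0
  deriv_zero : G' 0 = 0
  concave_deriv : ConcaveOn ℝ (Set.Ici 0) G'
  deriv_pos : ∀ x : ℝ, 0 < x → 0 < G' x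
  tendsto_deriv : Filter.Tendsto G' Filter.atTop Filter.atTop
  tendsto_div : Filter.Tendsto (fun x => G x / x) Filter.atTop Filter.atTop

end

/-- Rate at which a cluster of size `j` exports a unit, for the kernel restricted to sizes
at most `n`. -/
def exportRate (K : ℕ → ℕ → ℝ) (n : ℕ) (g : ℕ → ℝ) (j : ℕ) : ℝ :=
  if j < n + 1 then ∑ k ∈ Finset.range (n + 1), K j k * g k else 0

/-- Rate at which a cluster of size `j` imports a unit, for the kernel restricted to sizes
at most `n`. -/
def importRate (K : ℕ → ℕ → ℝ) (n : ℕ) (g : ℕ → ℝ) (j : ℕ) : ℝ :=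
  if j < n + 1 then ∑ k ∈ Finset.range n, K (k + 1) j * g (k + 1) else 0

/-- Net flux from size `j` to size `j + 1` for the restricted kernel. -/
def netFlux (K : ℕ → ℕ → ℝ) (n : ℕ) (g : ℕ → ℝ) (j : ℕ) : ℝ :=
  g j * importRate K n g j - g (j + 1) * exportRate K n g (j + 1)

/-- Vector field of the EDG system for the restricted kernel. -/
def restrictedRHS (K : ℕ → ℕ → ℝ) (n : ℕ) (g : ℕ → ℝ) : ℕ → ℝ
  | 0 => -netFlux K n g 0
  | j + 1 => netFlux K n g j - netFlux K n g (j + 1)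

/-- Explicit Euler scheme with step `h` for the restricted EDG system. -/
def eulerScheme (K : ℕ → ℕ → ℝ) (n : ℕ) (h : ℝ) (f0 : ℕ → ℝ) : ℕ → ℕ → ℝ
  | 0 => f0
  | i + 1 => fun j =>
      eulerScheme K n h f0 i j + h * restrictedRHS K n (eulerScheme K n h f0 i) j

lemma netFlux_eq_zero (K : ℕ → ℕ → ℝ) {n j : ℕ} (g : ℕ → ℝ) (hj : n < j) :
    netFlux K n g j = 0 := by
  have h1 : ¬ j < n + 1 := by omega
  have h2 : ¬ j + 1 < n + 1 := by omega
  simp [netFlux, importRate, exportRate, h1, h2]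

lemma restrictedRHS_eq_zero (K : ℕ → ℕ → ℝ) {n j : ℕ} (g : ℕ → ℝ) (hj : n + 1 < j) :
    restrictedRHS K n g j = 0 := by
  cases j with
  | zero => omega
  | succ j =>
    rw [restrictedRHS, netFlux_eq_zero K g (by omega), netFlux_eq_zero K g (by omega), sub_zero]

lemma sum_mul_restrictedRHS (K : ℕ → ℕ → ℝ) (n : ℕ) (g p : ℕ → ℝ) (m : ℕ) :
    ∑ j ∈ Finset.range (m + 1), p j * restrictedRHS K n g j
      = ∑ j ∈ Finset.range m, (p (j + 1) - p j) * netFlux K n g j - p m * netFlux K n g m := by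
  induction m with
  | zero => simp [restrictedRHS]
  | succ m ih =>
    rw [Finset.sum_range_succ, ih, Finset.sum_range_succ, restrictedRHS]
    ring

section Estimates

variable {K : ℕ → ℕ → ℝ} {C A : ℝ} {n : ℕ} {g : ℕ → ℝ}

lemma sum_mul_netFlux (D : ℕ → ℝ) :
    ∑ j ∈ Finset.range (n + 1), D j * netFlux K n g j
      = ∑ j ∈ Finset.range n, ∑ k ∈ Finset.range (n + 1),
          (D k - D j) * (K (j + 1) k * g (j + 1) * g k) := by
  have h1 : ∑ j ∈ Finset.range (n + 1), D j * (g j * importRate K n g j)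
      = ∑ j ∈ Finset.range n, ∑ k ∈ Finset.range (n + 1),
          D k * (K (j + 1) k * g (j + 1) * g k) := by
    rw [Finset.sum_comm]
    refine Finset.sum_congr rfl fun j hj => ?_
    rw [importRate, if_pos (Finset.mem_range.1 hj), Finset.mul_sum, Finset.mul_sum]
    exact Finset.sum_congr rfl fun k _ => by ring
  have h2 : ∑ j ∈ Finset.range (n + 1), D j * (g (j + 1) * exportRate K n g (j + 1))
      = ∑ j ∈ Finset.range n, ∑ k ∈ Finset.range (n + 1),
          D j * (K (j + 1) k * g (j + 1) * g k) := by
    rw [Finset.sum_range_succ]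
    have : exportRate K n g (n + 1) = 0 := by simp [exportRate]
    rw [this, mul_zero, mul_zero, add_zero]
    refine Finset.sum_congr rfl fun j hj => ?_
    have := Finset.mem_range.1 hj
    rw [exportRate, if_pos (by omega), Finset.mul_sum, Finset.mul_sum]
    exact Finset.sum_congr rfl fun k _ => by ring
  simp only [netFlux, mul_sub, Finset.sum_sub_distrib, h1, h2, sub_mul]

lemma sum_mul_restrictedRHS_le (hKnn : ∀ j k : ℕ, 0 ≤ K j k)
    (hKsym : ∀ j k : ℕ, K j k = K k j)
    (hKle : ∀ j k : ℕ, K j k ≤ C * ((1 + j) * (1 + k))) (hC : 0 ≤ C)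
    (hg : ∀ j, 0 ≤ g j) (hA : ∀ m, ∑ k ∈ Finset.range m, (1 + (k : ℝ)) * g k ≤ A)
    {p : ℕ → ℝ} {δ : ℝ} (hδ : 0 ≤ δ)
    (hp : ∀ j, p (j + 1) - p j ≤ p (j + 2) - p (j + 1))
    (hpδ : ∀ j, (p (j + 2) - p (j + 1)) - (p (j + 1) - p j) ≤ δ) :
    ∑ j ∈ Finset.range (n + 2), p j * restrictedRHS K n g j ≤ δ * (C * A ^ 2) := by
  rw [sum_mul_restrictedRHS, netFlux_eq_zero K g (Nat.lt_succ_self n), mul_zero, sub_zero]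
  set D : ℕ → ℝ := fun j => p (j + 1) - p j with hD
  have hmono : Monotone D := monotone_nat_of_le_succ hp
  rw [sum_mul_netFlux D]
  set W : ℕ → ℕ → ℝ := fun j k => K (j + 1) (k + 1) * g (j + 1) * g (k + 1) with hW
  have hWnn : ∀ j k, 0 ≤ W j k := fun j k =>
    mul_nonneg (mul_nonneg (hKnn _ _) (hg _)) (hg _)
  have hWsym : ∀ j k, W j k = W k j := fun j k => by
    simp only [hW, hKsym (j + 1) (k + 1)]; ring
  calc _ ≤ ∑ j ∈ Finset.range n, ∑ k ∈ Finset.range n, (D (k + 1) - D j) * W j k := by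
        refine Finset.sum_le_sum fun j _ => ?_
        rw [Finset.sum_range_succ']
        have : (D 0 - D j) * (K (j + 1) 0 * g (j + 1) * g 0) ≤ 0 :=
          mul_nonpos_of_nonpos_of_nonneg (sub_nonpos.2 (hmono (Nat.zero_le j)))
            (mul_nonneg (mul_nonneg (hKnn _ _) (hg _)) (hg _))
        linarith
    _ = ∑ j ∈ Finset.range n, ∑ k ∈ Finset.range n, (D (j + 1) - D j) * W j k := by
        simp only [sub_mul, Finset.sum_sub_distrib]
        congr 1
        rw [Finset.sum_comm]
        exact Finset.sum_congr rfl fun j _ => Finset.sum_congr rfl fun k _ => by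
          rw [hWsym]
    _ ≤ ∑ j ∈ Finset.range n, ∑ k ∈ Finset.range n,
          δ * (C * (((1 + ((j + 1 : ℕ) : ℝ)) * g (j + 1)) *
            ((1 + ((k + 1 : ℕ) : ℝ)) * g (k + 1)))) := by
        refine Finset.sum_le_sum fun j _ => Finset.sum_le_sum fun k _ => ?_
        refine mul_le_mul (hpδ j) ?_ (hWnn _ _) hδ
        have := mul_le_mul_of_nonneg_right (hKle (j + 1) (k + 1))
          (mul_nonneg (hg (j + 1)) (hg (k + 1)))
        simp only [hW]
        linarith
    _ = δ * (C * (∑ j ∈ Finset.range n, (1 + ((j + 1 : ℕ) : ℝ)) * g (j + 1)) ^ 2) := by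
        rw [sq, Finset.sum_mul_sum]
        simp only [Finset.mul_sum]
    _ ≤ δ * (C * A ^ 2) := by
        have h0 : 0 ≤ ∑ j ∈ Finset.range n, (1 + ((j + 1 : ℕ) : ℝ)) * g (j + 1) :=
          Finset.sum_nonneg fun j _ => mul_nonneg (by positivity) (hg _)
        have h1 := hA (n + 1)
        rw [Finset.sum_range_succ'] at h1
        have h2 : 0 ≤ (1 + ((0 : ℕ) : ℝ)) * g 0 := mul_nonneg (by positivity) (hg _)
        gcongr
        linarith

lemma kernel_sum_le (hKle : ∀ j k : ℕ, K j k ≤ C * ((1 + j) * (1 + k))) (hC : 0 ≤ C)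
    (hg : ∀ j, 0 ≤ g j) (hA : ∀ m, ∑ k ∈ Finset.range m, (1 + (k : ℝ)) * g k ≤ A)
    (j m : ℕ) : ∑ k ∈ Finset.range m, K j k * g k ≤ C * (1 + j) * A := by
  calc _ ≤ ∑ k ∈ Finset.range m, C * (1 + j) * ((1 + (k : ℝ)) * g k) := by
        refine Finset.sum_le_sum fun k _ => ?_
        have := mul_le_mul_of_nonneg_right (hKle j k) (hg k)
        linarith
    _ = C * (1 + j) * ∑ k ∈ Finset.range m, (1 + (k : ℝ)) * g k := by rw [Finset.mul_sum]
    _ ≤ _ := by gcongr; exact hA m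

lemma exportRate_nonneg (hKnn : ∀ j k : ℕ, 0 ≤ K j k) (hg : ∀ j, 0 ≤ g j) (j : ℕ) :
    0 ≤ exportRate K n g j := by
  unfold exportRate
  split_ifs
  · exact Finset.sum_nonneg fun k _ => mul_nonneg (hKnn _ _) (hg _)
  · exact le_rfl

lemma importRate_nonneg (hKnn : ∀ j k : ℕ, 0 ≤ K j k) (hg : ∀ j, 0 ≤ g j) (j : ℕ) :
    0 ≤ importRate K n g j := by
  unfold importRate
  split_ifs
  · exact Finset.sum_nonneg fun k _ => mul_nonneg (hKnn _ _) (hg _)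
  · exact le_rfl

lemma importRate_le_exportRate (hKnn : ∀ j k : ℕ, 0 ≤ K j k)
    (hKsym : ∀ j k : ℕ, K j k = K k j) (hg : ∀ j, 0 ≤ g j) (j : ℕ) :
    importRate K n g j ≤ exportRate K n g j := by
  unfold importRate exportRate
  split_ifs
  · rw [Finset.sum_range_succ']
    simp only [hKsym _ j]
    exact le_add_of_nonneg_right (mul_nonneg (hKnn _ _) (hg _))
  · exact le_rfl

lemma exportRate_le (hKle : ∀ j k : ℕ, K j k ≤ C * ((1 + j) * (1 + k))) (hC : 0 ≤ C)
    (hA0 : 0 ≤ A) (hg : ∀ j, 0 ≤ g j)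
    (hA : ∀ m, ∑ k ∈ Finset.range m, (1 + (k : ℝ)) * g k ≤ A) (j : ℕ) :
    exportRate K n g j ≤ C * (1 + j) * A := by
  unfold exportRate
  split_ifs
  · exact kernel_sum_le hKle hC hg hA j _
  · positivity

lemma exportRate_le_of_size (hKle : ∀ j k : ℕ, K j k ≤ C * ((1 + j) * (1 + k))) (hC : 0 ≤ C)
    (hA0 : 0 ≤ A) (hg : ∀ j, 0 ≤ g j)
    (hA : ∀ m, ∑ k ∈ Finset.range m, (1 + (k : ℝ)) * g k ≤ A) (j : ℕ) :
    exportRate K n g j ≤ C * (1 + n) * A := by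
  unfold exportRate
  split_ifs with h
  · refine (kernel_sum_le hKle hC hg hA j _).trans ?_
    have : (j : ℝ) ≤ n := by exact_mod_cast Nat.lt_succ_iff.1 h
    gcongr
  · positivity

lemma le_of_weighted_sum_le (hg : ∀ j, 0 ≤ g j)
    (hA : ∀ m, ∑ k ∈ Finset.range m, (1 + (k : ℝ)) * g k ≤ A) (j : ℕ) : g j ≤ A := by
  refine le_trans ?_ (hA (j + 1))
  rw [Finset.sum_range_succ]
  have h1 : 0 ≤ ∑ k ∈ Finset.range j, (1 + (k : ℝ)) * g k :=
    Finset.sum_nonneg fun k _ => mul_nonneg (by positivity) (hg k)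
  nlinarith [mul_nonneg (Nat.cast_nonneg (α := ℝ) j) (hg j)]

lemma abs_netFlux_le (hKnn : ∀ j k : ℕ, 0 ≤ K j k)
    (hKsym : ∀ j k : ℕ, K j k = K k j)
    (hKle : ∀ j k : ℕ, K j k ≤ C * ((1 + j) * (1 + k))) (hC : 0 ≤ C)
    (hA0 : 0 ≤ A) (hg : ∀ j, 0 ≤ g j)
    (hA : ∀ m, ∑ k ∈ Finset.range m, (1 + (k : ℝ)) * g k ≤ A) (j : ℕ) :
    |netFlux K n g j| ≤ C * (2 + j) * A ^ 2 := by
  have hb := (importRate_le_exportRate (n := n) hKnn hKsym hg j).trans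
    (exportRate_le hKle hC hA0 hg hA j)
  have ha := exportRate_le (n := n) hKle hC hA0 hg hA (j + 1)
  have h1 : g j * importRate K n g j ≤ A * (C * (1 + j) * A) :=
    mul_le_mul (le_of_weighted_sum_le hg hA j) hb (importRate_nonneg hKnn hg j) hA0
  have h2 : g (j + 1) * exportRate K n g (j + 1) ≤ A * (C * (1 + (j + 1 : ℕ)) * A) :=
    mul_le_mul (le_of_weighted_sum_le hg hA _) ha (exportRate_nonneg hKnn hg _) hA0
  have h3 : 0 ≤ g j * importRate K n g j := mul_nonneg (hg _) (importRate_nonneg hKnn hg _)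
  have h4 : 0 ≤ g (j + 1) * exportRate K n g (j + 1) :=
    mul_nonneg (hg _) (exportRate_nonneg hKnn hg _)
  have h5 : 0 ≤ C * A ^ 2 := by positivity
  push_cast at h2
  unfold netFlux
  rw [abs_le]
  constructor <;> nlinarith

lemma abs_restrictedRHS_le (hKnn : ∀ j k : ℕ, 0 ≤ K j k)
    (hKsym : ∀ j k : ℕ, K j k = K k j)
    (hKle : ∀ j k : ℕ, K j k ≤ C * ((1 + j) * (1 + k))) (hC : 0 ≤ C)
    (hA0 : 0 ≤ A) (hg : ∀ j, 0 ≤ g j)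
    (hA : ∀ m, ∑ k ∈ Finset.range m, (1 + (k : ℝ)) * g k ≤ A) (j : ℕ) :
    |restrictedRHS K n g j| ≤ 2 * (C * (2 + j) * A ^ 2) := by
  have H := abs_netFlux_le (n := n) hKnn hKsym hKle hC hA0 hg hA
  have h5 : 0 ≤ C * A ^ 2 := by positivity
  cases j with
  | zero =>
    rw [restrictedRHS, abs_neg]
    have := H 0
    push_cast at this ⊢
    nlinarith
  | succ j =>
    rw [restrictedRHS]
    have h1 := H j
    have h2 := H (j + 1)
    have h3 := abs_sub (netFlux K n g j) (netFlux K n g (j + 1))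
    push_cast at h2 ⊢
    nlinarith

lemma add_mul_restrictedRHS_nonneg (hKnn : ∀ j k : ℕ, 0 ≤ K j k)
    (hKsym : ∀ j k : ℕ, K j k = K k j)
    (hKle : ∀ j k : ℕ, K j k ≤ C * ((1 + j) * (1 + k))) (hC : 0 ≤ C)
    (hA0 : 0 ≤ A) (hg : ∀ j, 0 ≤ g j)
    (hA : ∀ m, ∑ k ∈ Finset.range m, (1 + (k : ℝ)) * g k ≤ A)
    {h : ℝ} (h0 : 0 ≤ h) (hh : h * (2 * (C * (1 + n) * A)) ≤ 1) (j : ℕ) :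
    0 ≤ g j + h * restrictedRHS K n g j := by
  have ha := exportRate_le_of_size (n := n) hKle hC hA0 hg hA j
  have hb := (importRate_le_exportRate (n := n) hKnn hKsym hg j).trans ha
  have hab : h * (exportRate K n g j + importRate K n g j) ≤ 1 :=
    (mul_le_mul_of_nonneg_left (by linarith) h0).trans hh
  have key : g j * (h * (exportRate K n g j + importRate K n g j)) ≤ g j * 1 :=
    mul_le_mul_of_nonneg_left hab (hg j)
  have e1 : 0 ≤ h * (g (j + 1) * exportRate K n g (j + 1)) :=
    mul_nonneg h0 (mul_nonneg (hg _) (exportRate_nonneg hKnn hg _))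
  cases j with
  | zero =>
    rw [restrictedRHS, netFlux]
    have e2 : 0 ≤ h * (g 0 * exportRate K n g 0) :=
      mul_nonneg h0 (mul_nonneg (hg _) (exportRate_nonneg hKnn hg _))
    nlinarith
  | succ j =>
    rw [restrictedRHS, netFlux, netFlux]
    have e2 : 0 ≤ h * (g j * importRate K n g j) :=
      mul_nonneg h0 (mul_nonneg (hg _) (importRate_nonneg hKnn hg _))
    nlinarith

lemma summable_mul_add_restrictedRHS {p : ℕ → ℝ} {h : ℝ} (hs : Summable fun j => p j * g j) :
    Summable fun j => p j * (g j + h * restrictedRHS K n g j) := by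
  have hfin : Summable fun j => h * (p j * restrictedRHS K n g j) :=
    summable_of_ne_finset_zero (s := Finset.range (n + 2)) fun j hj => by
      rw [restrictedRHS_eq_zero K g (by simpa [Nat.succ_le_iff] using hj)]; simp
  exact (hs.add hfin).congr fun j => by ring

lemma tsum_mul_add_restrictedRHS {p : ℕ → ℝ} {h : ℝ} (hs : Summable fun j => p j * g j) :
    ∑' j, p j * (g j + h * restrictedRHS K n g j)
      = ∑' j, p j * g j + h * ∑ j ∈ Finset.range (n + 2), p j * restrictedRHS K n g j := by
  have hz : ∀ j ∉ Finset.range (n + 2), h * (p j * restrictedRHS K n g j) = 0 := fun j hj => by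
    rw [restrictedRHS_eq_zero K g (by simpa [Nat.succ_le_iff] using hj)]; simp
  rw [Finset.mul_sum, ← tsum_eq_sum (L := SummationFilter.unconditional ℕ) hz, ← hs.tsum_add (summable_of_ne_finset_zero hz)]
  exact tsum_congr fun j => by ring

end Estimates

/-- A convex weight of linear growth with second differences at most `2 / R`. -/
noncomputable def tailWeight (R j : ℕ) : ℝ := (j : ℝ) ^ 2 / (R + j)

lemma tailWeight_nonneg (R j : ℕ) : 0 ≤ tailWeight R j := by
  unfold tailWeight; positivity

lemma tailWeight_le (R j : ℕ) : tailWeight R j ≤ 1 + j := by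
  unfold tailWeight
  refine div_le_of_le_mul₀ (by positivity) (by positivity) ?_
  have : (0 : ℝ) ≤ R := by positivity
  have : (0 : ℝ) ≤ j := by positivity
  nlinarith [mul_nonneg ‹(0 : ℝ) ≤ R› ‹(0 : ℝ) ≤ j›]

lemma one_add_le_tailWeight {R j : ℕ} (hR : 1 ≤ R) (hj : R ≤ j) :
    1 + (j : ℝ) ≤ 4 * tailWeight R j := by
  unfold tailWeight
  have h1 : (1 : ℝ) ≤ R := by exact_mod_cast hR
  have h2 : (R : ℝ) ≤ j := by exact_mod_cast hj
  rw [mul_div_assoc', le_div_iff₀ (by positivity)]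
  nlinarith

lemma tailWeight_second_difference {R : ℕ} (hR : 1 ≤ R) (j : ℕ) :
    (tailWeight R (j + 2) - tailWeight R (j + 1)) - (tailWeight R (j + 1) - tailWeight R j)
      = 2 * (R : ℝ) ^ 2 / ((R + j) * (R + j + 1) * (R + j + 2)) := by
  unfold tailWeight
  have h1 : (1 : ℝ) ≤ R := by exact_mod_cast hR
  have h2 : (0 : ℝ) ≤ j := by positivity
  have : (R : ℝ) + j ≠ 0 := by positivity
  have : (R : ℝ) + j + 1 ≠ 0 := by positivity
  have : (R : ℝ) + j + 2 ≠ 0 := by positivity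
  push_cast
  rw [show (R : ℝ) + (j + 2) = R + j + 2 by ring, show (R : ℝ) + (j + 1) = R + j + 1 by ring]
  field_simp
  ring

lemma tailWeight_convex {R : ℕ} (hR : 1 ≤ R) (j : ℕ) :
    tailWeight R (j + 1) - tailWeight R j ≤ tailWeight R (j + 2) - tailWeight R (j + 1) := by
  rw [← sub_nonneg, tailWeight_second_difference hR]
  positivity

lemma tailWeight_second_difference_le {R : ℕ} (hR : 1 ≤ R) (j : ℕ) :
    (tailWeight R (j + 2) - tailWeight R (j + 1)) - (tailWeight R (j + 1) - tailWeight R j)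
      ≤ 2 / R := by
  rw [tailWeight_second_difference hR]
  have h1 : (1 : ℝ) ≤ R := by exact_mod_cast hR
  have h2 : (0 : ℝ) ≤ j := by positivity
  rw [div_le_div_iff₀ (by positivity) (by positivity)]
  have h3 : (R : ℝ) * R * R ≤ (R + j) * (R + j + 1) * (R + j + 2) := by
    gcongr <;> linarith
  nlinarith

lemma tendsto_tsum_tailWeight {f0 : ℕ → ℝ} (hf : ∀ j, 0 ≤ f0 j)
    (hs : Summable fun j : ℕ => (1 + (j : ℝ)) * f0 j) :
    Tendsto (fun R => ∑' j, tailWeight R j * f0 j) atTop (nhds 0) := by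
  have : Tendsto (fun R => ∑' j, tailWeight R j * f0 j) atTop (nhds (∑' _ : ℕ, (0 : ℝ))) := by
    refine tendsto_tsum_of_dominated_convergence hs (fun j => ?_) (Eventually.of_forall fun R j => ?_)
    · have h1 : Tendsto (fun R : ℕ => (R : ℝ) + j) atTop atTop :=
        tendsto_atTop_add_const_right _ _ tendsto_natCast_atTop_atTop
      have h2 := (h1.const_div_atTop ((j : ℝ) ^ 2)).mul_const (f0 j)
      simpa [tailWeight] using h2
    · rw [Real.norm_of_nonneg (mul_nonneg (tailWeight_nonneg R j) (hf j))]
      exact mul_le_mul_of_nonneg_right (tailWeight_le R j) (hf j)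
  simpa using this

lemma weighted_sum_le_of_tsum_le {A : ℝ} {g : ℕ → ℝ} (hg : ∀ j, 0 ≤ g j)
    (hs : Summable fun j : ℕ => (1 + (j : ℝ)) * g j)
    (hA : ∑' j : ℕ, (1 + (j : ℝ)) * g j ≤ A) (m : ℕ) :
    ∑ k ∈ Finset.range m, (1 + (k : ℝ)) * g k ≤ A :=
  (hs.sum_le_tsum _ fun j _ => mul_nonneg (by positivity) (hg j)).trans hA

lemma summable_tailWeight {g : ℕ → ℝ} (hg : ∀ j, 0 ≤ g j)
    (hs : Summable fun j : ℕ => (1 + (j : ℝ)) * g j) (R : ℕ) :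
    Summable fun j => tailWeight R j * g j :=
  hs.of_nonneg_of_le (fun j => mul_nonneg (tailWeight_nonneg R j) (hg j))
    fun j => mul_le_mul_of_nonneg_right (tailWeight_le R j) (hg j)

section Scheme

variable {K : ℕ → ℕ → ℝ} {C A h : ℝ} {n : ℕ} {f0 : ℕ → ℝ}

lemma eulerScheme_bounds (hKnn : ∀ j k : ℕ, 0 ≤ K j k)
    (hKsym : ∀ j k : ℕ, K j k = K k j)
    (hKle : ∀ j k : ℕ, K j k ≤ C * ((1 + j) * (1 + k))) (hC : 0 ≤ C)
    (hA0 : 0 ≤ A) (hf : ∀ j, 0 ≤ f0 j)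
    (hs : Summable fun j : ℕ => (1 + (j : ℝ)) * f0 j)
    (hA : ∑' j : ℕ, (1 + (j : ℝ)) * f0 j ≤ A)
    (h0 : 0 ≤ h) (hh : h * (2 * (C * (1 + n) * A)) ≤ 1) (i : ℕ) :
    (∀ j, 0 ≤ eulerScheme K n h f0 i j) ∧
    (Summable fun j : ℕ => (1 + (j : ℝ)) * eulerScheme K n h f0 i j) ∧
    (∑' j : ℕ, (1 + (j : ℝ)) * eulerScheme K n h f0 i j ≤ A) ∧
    ∀ R : ℕ, 1 ≤ R → ∑' j, tailWeight R j * eulerScheme K n h f0 i j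
      ≤ ∑' j, tailWeight R j * f0 j + i * h * (2 / R * (C * A ^ 2)) := by
  induction i with
  | zero => exact ⟨hf, hs, hA, fun R _ => by simp [eulerScheme]⟩
  | succ i ih =>
    obtain ⟨ih1, ih2, ih3, ih4⟩ := ih
    have hA' := weighted_sum_le_of_tsum_le ih1 ih2 ih3
    refine ⟨fun j => add_mul_restrictedRHS_nonneg hKnn hKsym hKle hC hA0 ih1 hA' h0 hh j,
      summable_mul_add_restrictedRHS ih2, ?_, fun R hR => ?_⟩
    · simp only [eulerScheme]
      rw [tsum_mul_add_restrictedRHS ih2]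
      have := sum_mul_restrictedRHS_le (n := n) hKnn hKsym hKle hC ih1 hA'
        (p := fun j : ℕ => 1 + (j : ℝ)) (δ := 0) le_rfl
        (fun j => by push_cast; linarith) (fun j => by push_cast; linarith)
      rw [zero_mul] at this
      nlinarith [mul_nonneg h0 (neg_nonneg.2 this)]
    · simp only [eulerScheme]
      rw [tsum_mul_add_restrictedRHS (summable_tailWeight ih1 ih2 R)]
      have := sum_mul_restrictedRHS_le (n := n) hKnn hKsym hKle hC ih1 hA'
        (p := tailWeight R) (δ := 2 / R) (by positivity)
        (tailWeight_convex hR) (tailWeight_second_difference_le hR)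
      have h2 := mul_le_mul_of_nonneg_left this h0
      have h3 := ih4 R hR
      push_cast
      linarith

end Scheme

/-- The step function in time with value `x i` on `[i h, (i + 1) h)`. -/
noncomputable def stepFun (h : ℝ) (x : ℕ → ℝ) (t : ℝ) : ℝ := x ⌊t / h⌋₊

lemma measurable_stepFun (h : ℝ) (x : ℕ → ℝ) : Measurable (stepFun h x) :=
  (measurable_from_nat (f := x)).comp (Nat.measurable_floor.comp (measurable_id.div_const h))

lemma intervalIntegrable_stepFun {h B : ℝ} {x : ℕ → ℝ} (hB : ∀ i, |x i| ≤ B) (a b : ℝ) :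
    IntervalIntegrable (stepFun h x) volume a b := by
  rw [intervalIntegrable_iff]
  exact Measure.integrableOn_of_bounded (M := B) (by simp)
    (measurable_stepFun h x).aestronglyMeasurable (ae_of_all _ fun s => hB _)

lemma integral_stepFun {h B : ℝ} (hh : 0 < h) {x : ℕ → ℝ} (hB : ∀ i, |x i| ≤ B) (m : ℕ) :
    ∫ s in (0 : ℝ)..(m * h), stepFun h x s = ∑ i ∈ Finset.range m, h * x i := by
  have h1 := intervalIntegral.sum_integral_adjacent_intervals (μ := volume) (f := stepFun h x)
    (a := fun i : ℕ => (i : ℝ) * h) (n := m) (fun i _ => intervalIntegrable_stepFun hB _ _)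
  simp only [Nat.cast_zero, zero_mul] at h1
  rw [← h1]
  refine Finset.sum_congr rfl fun i _ => ?_
  have hle : (i : ℝ) * h ≤ (i + 1 : ℕ) * h := by push_cast; nlinarith
  have : ∫ s in ((i : ℝ) * h)..((i + 1 : ℕ) * h), stepFun h x s
      = ∫ _ in ((i : ℝ) * h)..((i + 1 : ℕ) * h), x i := by
    rw [intervalIntegral.integral_of_le hle, intervalIntegral.integral_of_le hle,
      ← integral_Ico_eq_integral_Ioc, ← integral_Ico_eq_integral_Ioc]
    refine setIntegral_congr_fun measurableSet_Ico fun s hs => ?_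
    have hs0 : 0 ≤ s := le_trans (by positivity) hs.1
    have : ⌊s / h⌋₊ = i := by
      rw [Nat.floor_eq_iff (by positivity)]
      exact ⟨(le_div_iff₀ hh).2 hs.1, (div_lt_iff₀ hh).2 (by simpa using hs.2)⟩
    simp [stepFun, this]
  rw [this, intervalIntegral.integral_const]
  push_cast
  rw [smul_eq_mul]
  ring

lemma abs_stepFun_sub_le {h L : ℝ} (hh : 0 < h) (hL : 0 ≤ L) {x : ℕ → ℝ}
    (hx : ∀ i, |x (i + 1) - x i| ≤ h * L) (s t : ℝ) :
    |stepFun h x t - stepFun h x s| ≤ L * (|t - s| + h) := by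
  have key : ∀ i k, |x (i + k) - x i| ≤ k * (h * L) := by
    intro i k
    induction k with
    | zero => simp
    | succ k ih =>
      have h1 := abs_sub_le (x (i + k + 1)) (x (i + k)) (x i)
      have h2 := hx (i + k)
      push_cast
      rw [← add_assoc]
      linarith
  wlog hst : s ≤ t generalizing s t
  · rw [abs_sub_comm, abs_sub_comm t s]
    exact this t s (le_of_not_ge hst)
  have hfl : ⌊s / h⌋₊ ≤ ⌊t / h⌋₊ := Nat.floor_mono (by gcongr)
  obtain ⟨k, hk⟩ := Nat.exists_eq_add_of_le hfl
  have hk2 : (k : ℝ) * h ≤ |t - s| + h := by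
    rw [abs_of_nonneg (sub_nonneg.2 hst)]
    rcases Nat.eq_zero_or_pos k with rfl | hkpos
    · simp; linarith
    have ht : (0 : ℝ) ≤ t / h := by
      by_contra hneg
      rw [Nat.floor_of_nonpos (le_of_not_ge hneg)] at hk
      omega
    have h1 := Nat.floor_le ht
    have h2 := Nat.lt_floor_add_one (s / h)
    have h3 : (⌊t / h⌋₊ : ℝ) = ⌊s / h⌋₊ + k := by exact_mod_cast hk
    have h4 : (k : ℝ) ≤ (t - s) / h + 1 := by rw [sub_div]; linarith
    calc (k : ℝ) * h ≤ ((t - s) / h + 1) * h := by gcongr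
      _ = _ := by field_simp
  unfold stepFun
  rw [hk]
  nlinarith [key ⌊s / h⌋₊ k]

/-- Asymptotically equi-Lipschitz, uniformly bounded families of functions of time have a
pointwise convergent subsequence. -/
lemma exists_subseq_tendsto_of_equiLipschitz {x : ℕ → ℝ → ℕ → ℝ} {A : ℝ} {L : ℕ → ℝ}
    {h : ℕ → ℝ} (hx : ∀ n t j, x n t j ∈ Set.Icc 0 A)
    (hL : ∀ n s t j, |x n t j - x n s j| ≤ L j * (|t - s| + h n)) (hL0 : ∀ j, 0 ≤ L j)
    (hh : Tendsto h atTop (nhds 0)) :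
    ∃ σ : ℕ → ℕ, StrictMono σ ∧ ∃ f : ℝ → ℕ → ℝ,
      ∀ t j, Tendsto (fun n => x (σ n) t j) atTop (nhds (f t j)) := by
  have hcpt : IsCompact (Set.univ.pi fun _ : ℚ × ℕ => Set.Icc (0 : ℝ) A) :=
    isCompact_univ_pi fun _ => isCompact_Icc
  obtain ⟨y, -, σ, hσ, hy⟩ := hcpt.tendsto_subseq
    (x := fun n (p : ℚ × ℕ) => x n (p.1 : ℝ) p.2) fun n p _ => hx n _ _
  rw [tendsto_pi_nhds] at hy
  refine ⟨σ, hσ, ?_⟩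
  have hc : ∀ t j, ∃ l, Tendsto (fun n => x (σ n) t j) atTop (nhds l) := by
    intro t j
    refine cauchySeq_tendsto_of_complete (Metric.cauchySeq_iff'.2 fun ε hε => ?_)
    set η := ε / (8 * (L j + 1)) with hη
    have hLj := hL0 j
    have hηpos : 0 < η := by positivity
    have hLη : L j * (2 * η) ≤ ε / 4 := by
      rw [hη]
      have : L j / (L j + 1) ≤ 1 := (div_le_one (by positivity)).2 (by linarith)
      calc L j * (2 * (ε / (8 * (L j + 1)))) = (L j / (L j + 1)) * (ε / 4) := by
            field_simp; ring
        _ ≤ 1 * (ε / 4) := by gcongr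
        _ = _ := one_mul _
    obtain ⟨q, hq1, hq2⟩ := exists_rat_btwn (show t < t + η by linarith)
    have hh' : ∀ᶠ n in atTop, h (σ n) < η :=
      (hh.comp hσ.tendsto_atTop).eventually (gt_mem_nhds hηpos)
    have hcq := Metric.cauchySeq_iff.1 (hy (q, j)).cauchySeq (ε / 2) (by positivity)
    obtain ⟨N1, hN1⟩ := hcq
    obtain ⟨N2, hN2⟩ := eventually_atTop.1 hh'
    refine ⟨max N1 N2, fun n hn => ?_⟩
    have e1 := hN1 n (le_trans (le_max_left _ _) hn) (max N1 N2) (le_max_left _ _)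
    have hclose : ∀ m, N2 ≤ m → |x (σ m) t j - x (σ m) q j| ≤ ε / 4 := fun m hm => by
      refine (hL (σ m) q t j).trans (le_trans ?_ hLη)
      gcongr
      have := hN2 m hm
      rw [abs_sub_comm, abs_of_pos (by linarith)]
      linarith
    have e2 := hclose n (le_trans (le_max_right _ _) hn)
    have e3 := hclose (max N1 N2) (le_max_right _ _)
    simp only [Real.dist_eq, Function.comp] at e1 ⊢
    rw [abs_lt] at *
    rw [abs_le] at e2 e3
    constructor <;> linarith
  choose f hf using hc
  exact ⟨f, hf⟩

/-- Convergence of truncated series under a uniform tail condition. -/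
lemma tendsto_sum_range_of_uniform_tail {c : ℕ → ℝ} {x : ℕ → ℕ → ℝ} {y : ℕ → ℝ} {N : ℕ → ℕ}
    (hc : ∀ k, 0 ≤ c k) (hx : ∀ n k, 0 ≤ x n k)
    (hxy : ∀ k, Tendsto (fun n => x n k) atTop (nhds (y k)))
    (hN : Tendsto N atTop atTop)
    (htail : ∀ ε > 0, ∃ R, ∀ n m, ∑ k ∈ Finset.Ico R m, c k * x n k ≤ ε) :
    Summable (fun k => c k * y k) ∧
    Tendsto (fun n => ∑ k ∈ Finset.range (N n), c k * x n k) atTop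
      (nhds (∑' k, c k * y k)) := by
  have hy : ∀ k, 0 ≤ y k := fun k => ge_of_tendsto' (hxy k) fun n => hx n k
  have hnn : ∀ k, 0 ≤ c k * y k := fun k => mul_nonneg (hc k) (hy k)
  have hsum : ∀ s : Finset ℕ, Tendsto (fun n => ∑ k ∈ s, c k * x n k) atTop
      (nhds (∑ k ∈ s, c k * y k)) := fun s =>
    tendsto_finsetSum s fun k _ => (hxy k).const_mul (c k)
  have htaily : ∀ ε > 0, ∃ R, (∀ n m, ∑ k ∈ Finset.Ico R m, c k * x n k ≤ ε) ∧
      ∀ m, ∑ k ∈ Finset.Ico R m, c k * y k ≤ ε := fun ε hε => by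
    obtain ⟨R, hR⟩ := htail ε hε
    exact ⟨R, hR, fun m => le_of_tendsto' (hsum _) fun n => hR n m⟩
  have hS : Summable (fun k => c k * y k) := by
    obtain ⟨R, -, hR⟩ := htaily 1 one_pos
    refine summable_of_sum_range_le (c := ∑ k ∈ Finset.range R, c k * y k + 1) hnn fun m => ?_
    calc _ ≤ ∑ k ∈ Finset.range (max R m), c k * y k :=
          Finset.sum_le_sum_of_subset_of_nonneg
            (Finset.range_mono (le_max_right _ _)) fun k _ _ => hnn k
      _ = _ := (Finset.sum_range_add_sum_Ico _ (le_max_left R m)).symm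
      _ ≤ _ := by gcongr; exact hR _
  refine ⟨hS, Metric.tendsto_atTop'.2 fun ε hε => ?_⟩
  obtain ⟨R, hRx, hRy⟩ := htaily (ε / 4) (by positivity)
  have e1 := (Metric.tendsto_nhds.1 (hsum (Finset.range R))) (ε / 4) (by positivity)
  have e2 := hN.eventually (eventually_ge_atTop R)
  obtain ⟨n0, hn0⟩ := eventually_atTop.1 (e1.and e2)
  refine ⟨n0, fun n hn => ?_⟩
  obtain ⟨h1, h2⟩ := hn0 n hn.le
  rw [← Finset.sum_range_add_sum_Ico _ h2]
  have h3 := hRx n (N n)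
  have h4 : 0 ≤ ∑ k ∈ Finset.Ico R (N n), c k * x n k :=
    Finset.sum_nonneg fun k _ => mul_nonneg (hc k) (hx n k)
  have h5 : ∑ k ∈ Finset.range R, c k * y k ≤ ∑' k, c k * y k :=
    hS.sum_le_tsum _ fun k _ => hnn k
  have h6 : ∑' k, c k * y k ≤ ∑ k ∈ Finset.range R, c k * y k + ε / 4 := by
    refine hS.tsum_le_of_sum_range_le fun m => ?_
    calc _ ≤ ∑ k ∈ Finset.range (max R m), c k * y k :=
          Finset.sum_le_sum_of_subset_of_nonneg
            (Finset.range_mono (le_max_right _ _)) fun k _ _ => hnn k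
      _ = _ := (Finset.sum_range_add_sum_Ico _ (le_max_left R m)).symm
      _ ≤ _ := by gcongr; exact hRy _
  rw [Real.dist_eq, abs_lt] at *
  constructor <;> linarith

lemma eulerScheme_eq_sum (K : ℕ → ℕ → ℝ) (n : ℕ) (h : ℝ) (f0 : ℕ → ℝ) (i j : ℕ) :
    eulerScheme K n h f0 i j
      = f0 j + ∑ l ∈ Finset.range i, h * restrictedRHS K n (eulerScheme K n h f0 l) j := by
  induction i with
  | zero => simp [eulerScheme]
  | succ i ih => rw [Finset.sum_range_succ, ← add_assoc, ← ih, eulerScheme]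

/-- The restricted vector fields converge to the EDG vector field along sequences whose first
moments have uniformly small tails. -/
lemma tendsto_restrictedRHS {K : ℕ → ℕ → ℝ} {C : ℝ} (hKnn : ∀ j k : ℕ, 0 ≤ K j k)
    (hKsym : ∀ j k : ℕ, K j k = K k j)
    (hKle : ∀ j k : ℕ, K j k ≤ C * ((1 + j) * (1 + k))) (hC : 0 ≤ C)
    {x : ℕ → ℕ → ℝ} {y : ℕ → ℝ} {N : ℕ → ℕ} (hx : ∀ n k, 0 ≤ x n k)
    (hxy : ∀ k, Tendsto (fun n => x n k) atTop (nhds (y k)))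
    (hN : Tendsto N atTop atTop)
    (htail : ∀ ε > 0, ∃ R : ℕ, ∀ n m : ℕ, ∑ k ∈ Finset.Ico R m, (1 + (k : ℝ)) * x n k ≤ ε) (j : ℕ) :
    Summable (fun k => K j k * y k) ∧
    Tendsto (fun n => exportRate K (N n) (x n) j) atTop (nhds (∑' k, K j k * y k)) ∧
    Tendsto (fun n => restrictedRHS K (N n) (x n) j) atTop (nhds (edgRHS K y j)) := by
  have main : ∀ j, Summable (fun k => K j k * y k) ∧
      Tendsto (fun n => ∑ k ∈ Finset.range (N n + 1), K j k * x n k) atTop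
        (nhds (∑' k, K j k * y k)) := fun j => by
    refine tendsto_sum_range_of_uniform_tail (hKnn j) hx hxy
      ((tendsto_add_atTop_nat 1).comp hN) fun ε hε => ?_
    obtain ⟨R, hR⟩ := htail (ε / (C * (1 + j) + 1)) (by positivity)
    refine ⟨R, fun n m => ?_⟩
    calc ∑ k ∈ Finset.Ico R m, K j k * x n k
        ≤ ∑ k ∈ Finset.Ico R m, (C * (1 + j) + 1) * ((1 + (k : ℝ)) * x n k) := by
          refine Finset.sum_le_sum fun k _ => ?_
          have h1 := mul_le_mul_of_nonneg_right (hKle j k) (hx n k)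
          have h2 : 0 ≤ (1 + (k : ℝ)) * x n k := mul_nonneg (by positivity) (hx n k)
          linarith
      _ = (C * (1 + j) + 1) * ∑ k ∈ Finset.Ico R m, (1 + (k : ℝ)) * x n k := by
          rw [Finset.mul_sum]
      _ ≤ (C * (1 + j) + 1) * (ε / (C * (1 + j) + 1)) := by gcongr; exact hR n m
      _ = ε := by field_simp
  have hlarge : ∀ j, ∀ᶠ n in atTop, j < N n + 1 := fun j =>
    (hN.eventually (eventually_ge_atTop j)).mono fun n hn => Nat.lt_succ_of_le hn
  have hexp : ∀ j, Tendsto (fun n => exportRate K (N n) (x n) j) atTop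
      (nhds (∑' k, K j k * y k)) := fun j =>
    (main j).2.congr' ((hlarge j).mono fun n hn => by simp only [exportRate, if_pos hn])
  have himp : ∀ j, Tendsto (fun n => importRate K (N n) (x n) j) atTop
      (nhds (∑' k, K (k + 1) j * y (k + 1))) := fun j => by
    have e : ∑' k, K (k + 1) j * y (k + 1) = ∑' k, K j k * y k - K j 0 * y 0 := by
      rw [(main j).1.tsum_eq_zero_add]
      simp only [hKsym _ j, add_sub_cancel_left]
    rw [e]
    refine ((main j).2.sub ((hxy 0).const_mul (K j 0))).congr' ((hlarge j).mono fun n hn => ?_)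
    simp only [importRate, if_pos hn]
    rw [Finset.sum_range_succ']
    simp only [hKsym _ j, add_sub_cancel_right]
  have hflux : ∀ j, Tendsto (fun n => netFlux K (N n) (x n) j) atTop
      (nhds (y j * (∑' k, K (k + 1) j * y (k + 1)) - y (j + 1) * ∑' k, K (j + 1) k * y k)) :=
    fun j => ((hxy j).mul (himp j)).sub ((hxy (j + 1)).mul (hexp (j + 1)))
  refine ⟨(main j).1, hexp j, ?_⟩
  cases j with
  | zero =>
    have h1 := (hflux 0).neg
    rw [neg_sub] at h1
    exact h1
  | succ j =>
    refine ((hflux j).sub (hflux (j + 1))).trans_eq ?_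
    congr 1
    simp only [edgRHS]
    ring

/-- Global existence of mild solutions for kernels bounded by a product of linear functions. -/
theorem exists_mildSolution_of_kernel_le {K : ℕ → ℕ → ℝ} {C : ℝ} {f0 : ℕ → ℝ}
    (hKnn : ∀ j k : ℕ, 0 ≤ K j k) (hKsym : ∀ j k : ℕ, K j k = K k j)
    (hKle : ∀ j k : ℕ, K j k ≤ C * ((1 + j) * (1 + k))) (hC : 0 ≤ C)
    (hf : ∀ j, 0 ≤ f0 j) (hs : Summable fun j : ℕ => (1 + (j : ℝ)) * f0 j) :
    ∃ f : ℝ → ℕ → ℝ, f 0 = f0 ∧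
      ∀ T : ℝ, 0 < T → IsMildSolutionOn K 1 f (Set.Ico 0 T) := by
  set A : ℝ := ∑' j : ℕ, (1 + (j : ℝ)) * f0 j with hAdef
  have hA0 : 0 ≤ A := tsum_nonneg fun j => mul_nonneg (by positivity) (hf j)
  set h : ℕ → ℝ := fun n => 1 / ((n : ℝ) + 1) * (1 / (2 * C * A + 1)) with hhdef
  have hpos : ∀ n, 0 < h n := fun n => by positivity
  have hlim : Tendsto h atTop (nhds 0) := by
    simpa [h] using tendsto_one_div_add_atTop_nhds_zero_nat.mul_const (1 / (2 * C * A + 1))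
  have hh : ∀ n, h n * (2 * (C * (1 + n) * A)) ≤ 1 := fun n => by
    have h1 : 2 * C * A / (2 * C * A + 1) ≤ 1 :=
      (div_le_one (by positivity)).2 (by linarith)
    calc h n * (2 * (C * (1 + n) * A)) = 2 * C * A / (2 * C * A + 1) := by
          simp only [hhdef]; field_simp; ring
      _ ≤ 1 := h1
  set e : ℕ → ℕ → ℕ → ℝ := fun n i => eulerScheme K n (h n) f0 i with he
  have hb := fun n i => eulerScheme_bounds (i := i) hKnn hKsym hKle hC hA0 hf hs le_rfl
    (hpos n).le (hh n)
  have hnn : ∀ n i j, 0 ≤ e n i j := fun n i => (hb n i).1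
  have hA : ∀ n i m, ∑ k ∈ Finset.range m, (1 + (k : ℝ)) * e n i k ≤ A := fun n i =>
    weighted_sum_le_of_tsum_le (hb n i).1 (hb n i).2.1 (hb n i).2.2.1
  set L : ℕ → ℝ := fun j => 2 * (C * (2 + j) * A ^ 2) with hLdef
  have hL0 : ∀ j, 0 ≤ L j := fun j => by positivity
  have hQ : ∀ n i j, |restrictedRHS K n (e n i) j| ≤ L j := fun n i j =>
    abs_restrictedRHS_le hKnn hKsym hKle hC hA0 (hnn n i) (hA n i) j
  have hLip : ∀ n s t j, |stepFun (h n) (fun i => e n i j) t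
      - stepFun (h n) (fun i => e n i j) s| ≤ L j * (|t - s| + h n) := fun n s t j => by
    refine abs_stepFun_sub_le (hpos n) (hL0 j) (fun i => ?_) s t
    have : e n (i + 1) j - e n i j = h n * restrictedRHS K n (e n i) j := by
      simp only [he, eulerScheme, add_sub_cancel_left]
    rw [this, abs_mul, abs_of_pos (hpos n)]
    exact mul_le_mul_of_nonneg_left (hQ n i j) (hpos n).le
  obtain ⟨σ, hσ, f, hfl⟩ := exists_subseq_tendsto_of_equiLipschitz
    (x := fun n t j => stepFun (h n) (fun i => e n i j) t) (A := A)
    (fun n t j => ⟨hnn _ _ _, le_of_weighted_sum_le (hnn _ _) (hA _ _) j⟩) hLip hL0 hlim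
  have hlimσ : Tendsto (fun n => h (σ n)) atTop (nhds 0) := hlim.comp hσ.tendsto_atTop
  have htail : ∀ t : ℝ, ∀ ε > 0, ∃ R : ℕ, ∀ n m : ℕ,
      ∑ k ∈ Finset.Ico R m, (1 + (k : ℝ)) * e (σ n) ⌊t / h (σ n)⌋₊ k ≤ ε := by
    intro t ε hε
    have h1 := tendsto_tsum_tailWeight hf hs
    have h2 := (tendsto_const_div_atTop_nhds_zero_nat 2).mul_const (C * A ^ 2)
      |>.const_mul (max t 0)
    have h3 := (h1.add h2).const_mul 4
    simp only [zero_mul, mul_zero, add_zero] at h3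
    obtain ⟨R, hRε, hR1⟩ := ((h3.eventually (gt_mem_nhds hε)).and (eventually_ge_atTop 1)).exists
    refine ⟨R, fun n m => ?_⟩
    have h4 := (hb (σ n) ⌊t / h (σ n)⌋₊)
    have h5 : (⌊t / h (σ n)⌋₊ : ℝ) * h (σ n) ≤ max t 0 := by
      rcases le_total 0 t with ht | ht
      · have := Nat.floor_le (div_nonneg ht (hpos (σ n)).le)
        exact ((le_div_iff₀ (hpos _)).1 this).trans (le_max_left _ _)
      · rw [Nat.floor_of_nonpos (div_nonpos_of_nonpos_of_nonneg ht (hpos _).le)]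
        simp
    calc ∑ k ∈ Finset.Ico R m, (1 + (k : ℝ)) * e (σ n) ⌊t / h (σ n)⌋₊ k
        ≤ ∑ k ∈ Finset.Ico R m, 4 * (tailWeight R k * e (σ n) ⌊t / h (σ n)⌋₊ k) := by
          refine Finset.sum_le_sum fun k hk => ?_
          rw [← mul_assoc]
          exact mul_le_mul_of_nonneg_right
            (one_add_le_tailWeight hR1 (Finset.mem_Ico.1 hk).1) (hnn _ _ _)
      _ = 4 * ∑ k ∈ Finset.Ico R m, tailWeight R k * e (σ n) ⌊t / h (σ n)⌋₊ k := by
          rw [Finset.mul_sum]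
      _ ≤ 4 * (∑' j, tailWeight R j * f0 j + max t 0 * (2 / R * (C * A ^ 2))) := by
          gcongr
          refine ((summable_tailWeight h4.1 h4.2.1 R).sum_le_tsum _ fun k _ =>
            mul_nonneg (tailWeight_nonneg R k) (hnn _ _ _)).trans ((h4.2.2.2 R hR1).trans ?_)
          gcongr
      _ ≤ ε := hRε.le
  have hfnn : ∀ t j, 0 ≤ f t j := fun t j => ge_of_tendsto' (hfl t j) fun n => hnn _ _ _
  have hmom : ∀ t, Summable (fun j : ℕ => (1 + (j : ℝ)) * f t j) ∧
      ∑' j : ℕ, (1 + (j : ℝ)) * f t j ≤ A := fun t => by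
    obtain ⟨h1, h2⟩ := tendsto_sum_range_of_uniform_tail (N := id)
      (c := fun k => 1 + (k : ℝ)) (x := fun n => e (σ n) ⌊t / h (σ n)⌋₊)
      (fun k => by positivity) (fun n => hnn _ _) (hfl t) tendsto_id (htail t)
    exact ⟨h1, le_of_tendsto' h2 fun n => hA _ _ _⟩
  have hconv := fun t => tendsto_restrictedRHS (x := fun n => e (σ n) ⌊t / h (σ n)⌋₊) (y := f t)
    hKnn hKsym hKle hC (fun n => hnn _ _) (hfl t) hσ.tendsto_atTop (htail t)
  have hfLip : ∀ j s t, |f t j - f s j| ≤ L j * |t - s| := fun j s t => by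
    have h1 := ((hfl t j).sub (hfl s j)).abs
    have h2 := (hlimσ.const_add |t - s|).const_mul (L j)
    rw [add_zero] at h2
    exact le_of_tendsto_of_tendsto' h1 h2 fun n => hLip (σ n) s t j
  have hfcont : ∀ j, Continuous fun t => f t j := fun j =>
    (LipschitzWith.of_dist_le_mul (K := ⟨L j, hL0 j⟩) fun t s => hfLip j s t).continuous
  have hinit : f 0 = f0 := funext fun j => by
    refine tendsto_nhds_unique (hfl 0 j) (tendsto_const_nhds.congr fun n => ?_)
    simp [stepFun, he, eulerScheme]
  have hint : ∀ t, 0 ≤ t → ∀ j, f t j = f 0 j + ∫ s in (0 : ℝ)..t, edgRHS K (f s) j := by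
    intro t ht j
    set q : ℕ → ℝ → ℝ := fun n =>
      stepFun (h (σ n)) (fun i => restrictedRHS K (σ n) (e (σ n) i) j) with hq
    have hqi : ∀ n a b, IntervalIntegrable (q n) volume a b := fun n a b =>
      intervalIntegrable_stepFun (fun i => hQ (σ n) i j) a b
    have h1 : Tendsto (fun n => ∫ s in (0 : ℝ)..t, q n s) atTop
        (nhds (∫ s in (0 : ℝ)..t, edgRHS K (f s) j)) :=
      intervalIntegral.tendsto_integral_filter_of_dominated_convergence (fun _ => L j)
        (Eventually.of_forall fun n => (measurable_stepFun _ _).aestronglyMeasurable)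
        (Eventually.of_forall fun n => ae_of_all _ fun s _ => hQ _ _ _)
        intervalIntegrable_const (ae_of_all _ fun s _ => (hconv s j).2.2)
    have h2 : Tendsto (fun n => ∫ s in (⌊t / h (σ n)⌋₊ * h (σ n))..t, q n s) atTop (nhds 0) := by
      refine squeeze_zero_norm (a := fun n => L j * h (σ n)) (fun n => ?_)
        (by simpa using hlimσ.const_mul (L j))
      refine (intervalIntegral.norm_integral_le_of_norm_le_const
        (C := L j) fun s _ => hQ _ _ _).trans ?_
      refine mul_le_mul_of_nonneg_left ?_ (hL0 j)
      have h3 := (le_div_iff₀ (hpos (σ n))).1 (Nat.floor_le (div_nonneg ht (hpos (σ n)).le))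
      have h4 := (div_lt_iff₀ (hpos (σ n))).1 (Nat.lt_floor_add_one (t / h (σ n)))
      rw [abs_of_nonneg (by linarith)]
      linarith
    refine tendsto_nhds_unique (hfl t j) ?_
    have h5 := (h1.sub h2).const_add (f 0 j)
    rw [sub_zero] at h5
    refine h5.congr fun n => ?_
    rw [← intervalIntegral.integral_add_adjacent_intervals (hqi n 0 _) (hqi n _ t),
      add_sub_cancel_right, hq, integral_stepFun (hpos _) (fun i => hQ (σ n) i j), hinit]
    exact (eulerScheme_eq_sum K (σ n) (h (σ n)) f0 _ j).symm
  refine ⟨f, hinit, fun T hT => ⟨fun t _ => ⟨hfnn t, ?_⟩, fun j => (hfcont j).continuousOn,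
    ⟨A, fun t _ => ?_⟩, fun t _ j => (hconv t j).1, fun t _ j => ?_,
    fun t ht => hint t ht.1 0, fun t ht m => hint t ht.1 (m + 1)⟩⟩
  · simp only [Real.rpow_one]
    refine (hmom t).1.of_nonneg_of_le (fun j => mul_nonneg (by positivity) (hfnn t j)) fun j => ?_
    exact mul_le_mul_of_nonneg_right (by linarith) (hfnn t j)
  · simp only [Real.rpow_one]
    refine le_trans ?_ (hmom t).2
    have hle : ∀ j : ℕ, (j : ℝ) * f t j ≤ (1 + (j : ℝ)) * f t j := fun j =>
      mul_le_mul_of_nonneg_right (by linarith) (hfnn t j)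
    exact ((hmom t).1.of_nonneg_of_le
      (fun j => mul_nonneg (by positivity) (hfnn t j)) hle).tsum_le_tsum hle (hmom t).1
  · have hmeas : Measurable fun s => ∑' k, K j k * f s k :=
      measurable_of_tendsto_metrizable
        (f := fun n => stepFun (h (σ n)) fun i => exportRate K (σ n) (e (σ n) i) j)
        (fun n => measurable_stepFun _ _)
        (tendsto_pi_nhds.2 fun s => (hconv s j).2.1)
    refine Measure.integrableOn_of_bounded (M := C * (1 + j) * A) (by simp)
      hmeas.aestronglyMeasurable (ae_of_all _ fun s => ?_)
    rw [Real.norm_of_nonneg (tsum_nonneg fun k => mul_nonneg (hKnn _ _) (hfnn _ _))]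
    exact le_of_tendsto' (hconv s j).2.1 fun n =>
      exportRate_le hKle hC hA0 (hnn _ _) (hA _ _) j

lemma rpow_le_one_add_natCast {p : ℝ} (h0 : 0 ≤ p) (h1 : p ≤ 1) (j : ℕ) :
    (j : ℝ) ^ p ≤ 1 + j := by
  have hj : (0 : ℝ) ≤ j := by positivity
  calc (j : ℝ) ^ p ≤ (1 + (j : ℝ)) ^ p := Real.rpow_le_rpow hj (by linarith) h0
    _ ≤ (1 + (j : ℝ)) ^ (1 : ℝ) := Real.rpow_le_rpow_of_exponent_le (by linarith) h1
    _ = 1 + j := Real.rpow_one _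

/-- Theorem 2.2(b), global existence for `max{μ,ν} ≤ 1`. -/
theorem edg_global_existence_low (K : ℕ → ℕ → ℝ) (Cq μ ν : ℝ) (f0 : ℕ → ℝ)
    (hKnn : ∀ j k : ℕ, 0 ≤ K j k) (hKsym : ∀ j k : ℕ, K j k = K k j) (hCq : 0 < Cq)
    (hμ : μ ∈ Set.Icc (0:ℝ) 2) (hν : ν ∈ Set.Icc (0:ℝ) 2) (hμν : μ + ν ≤ 3)
    (hKle : ∀ j k : ℕ, K j k ≤ Cq * ((j : ℝ) ^ μ * (k : ℝ) ^ ν + (j : ℝ) ^ ν * (k : ℝ) ^ μ))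
    (hlam : max μ ν ≤ 1) (hf0 : MemYplus 1 f0) :
    ∃ f : ℝ → ℕ → ℝ, f 0 = f0 ∧
      ∀ T : ℝ, 0 < T → IsMildSolutionOn K 1 f (Set.Ico 0 T) := by
  have hμ1 : μ ≤ 1 := (le_max_left _ _).trans hlam
  have hν1 : ν ≤ 1 := (le_max_right _ _).trans hlam
  refine exists_mildSolution_of_kernel_le (C := 2 * Cq) hKnn hKsym (fun j k => ?_)
    (by positivity) hf0.1 ?_
  · refine (hKle j k).trans ?_
    have h1 : (j : ℝ) ^ μ * (k : ℝ) ^ ν ≤ (1 + j) * (1 + k) :=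
      mul_le_mul (rpow_le_one_add_natCast hμ.1 hμ1 j) (rpow_le_one_add_natCast hν.1 hν1 k)
        (by positivity) (by positivity)
    have h2 : (j : ℝ) ^ ν * (k : ℝ) ^ μ ≤ (1 + j) * (1 + k) :=
      mul_le_mul (rpow_le_one_add_natCast hν.1 hν1 j) (rpow_le_one_add_natCast hμ.1 hμ1 k)
        (by positivity) (by positivity)
    have h3 := mul_le_mul_of_nonneg_left (add_le_add h1 h2) hCq.le
    linarith
  · have hs := hf0.2
    simp only [Real.rpow_one] at hs
    rw [← summable_nat_add_iff 1] at hs ⊢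
    refine (hs.mul_left 2).of_nonneg_of_le (fun j => mul_nonneg (by positivity) (hf0.1 _))
      fun j => ?_
    have := mul_nonneg (Nat.cast_nonneg (α := ℝ) j) (hf0.1 (j + 1))
    push_cast
    nlinarith
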